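/- Fix real numbers a < b and an integer q ≥ 2, and fix real coefficients c_0, …, c_{⌊q/2⌋}. For each n ≥ 1 let h_n, h'_n : [na,nb] × [0,1] → ℝ and v_n : [na,nb] → ℝ be measurable, and suppose there are constants c₀, C₀ > 0, independent of n, such that for all s, t ∈ [na,nb]: ∫_0^1 h_n(s,λ)² dλ = ∫_0^1 h'_n(s,λ)² dλ = 1; |∫_0^1 h_n(s,λ) h_n(t,λ) dλ| ≤ C₀/(|s−t|+1); |∫_0^1 h_n(s,λ) h'_n(t,λ) dλ| ≤ C₀/(|s−t|+1); |∫_0^1 h'_n(s,λ) h'_n(t,λ) dλ| ≤ C₀/(|s−t|+1); and c₀ ≤ v_n(s) ≤ C₀. Define g_q^{(n)} : [0,1]^q → ℝ by g_q^{(n)}(λ_1,…,λ_q) = n^{−1/2} ∫_{na}^{nb} Σ_{l=0}^{⌊q/2⌋} c_l · (∏_{k=1}^{q−2l} h_n(s,λ_k)) · (∏_{k=q−2l+1}^{q} h'_n(s,λ_k)) · v_n(s) ds. Then for every integer p with 1 ≤ p ≤ q−1, lim_{n→∞} ∫_{[0,1]^{q−p}} ∫_{[0,1]^{q−p}} ( ∫_{[0,1]^p}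 g_q^{(n)}(x,λ) g_q^{(n)}(x,λ') dx )² dλ dλ' = 0; that is, the L² norm of the p-th contraction g_q^{(n)} ⊗_p g_q^{(n)} tends to 0. -/

import Mathlib

set_option autoImplicit false

open MeasureTheory Real Set Filter

section Contraction

variable {T A B X : Type*} [MeasurableSpace T] [MeasurableSpace A] [MeasurableSpace B]
  [MeasurableSpace X]

lemma memLp_two_uncurry_of_integral_sq_le {ν : Measure T} {ξ : Measure X} [SFinite ν] [SFinite ξ]
    {f : T → X → ℝ} (hf : Measurable (Function.uncurry f))
    (hsq : ∀ τ, Integrable (fun x => f τ x ^ 2) ξ) {φ : T → ℝ} (hφ : Integrable φ ν)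
    (hle : ∀ τ, ∫ x, f τ x ^ 2 ∂ξ ≤ φ τ) :
    MemLp (Function.uncurry f) 2 (ν.prod ξ) := by
  rw [memLp_two_iff_integrable_sq hf.aestronglyMeasurable]
  have hm : Measurable (fun z : T × X => Function.uncurry f z ^ 2) := hf.pow_const 2
  rw [integrable_prod_iff hm.aestronglyMeasurable]
  refine ⟨Eventually.of_forall hsq, hφ.mono' ?_ (Eventually.of_forall fun τ => ?_)⟩
  · exact hm.norm.stronglyMeasurable.integral_prod_right.aestronglyMeasurable
  · have h0 : 0 ≤ ∫ x, f τ x ^ 2 ∂ξ := integral_nonneg fun x => sq_nonneg _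
    simpa [Function.uncurry, abs_of_nonneg h0] using hle τ

lemma integrable_integral_mul_integral {ν : Measure T} {ξ : Measure X} [IsFiniteMeasure ν]
    [SFinite ξ] {f g : T → X → ℝ} (hf : MemLp (Function.uncurry f) 2 (ν.prod ξ))
    (hg : MemLp (Function.uncurry g) 2 (ν.prod ξ)) :
    Integrable (fun x => (∫ τ, f τ x ∂ν) * ∫ τ, g τ x ∂ν) ξ ∧
      ∫ x, (∫ τ, f τ x ∂ν) * (∫ τ, g τ x ∂ν) ∂ξ =
        ∫ z : T × T, ∫ x, f z.1 x * g z.2 x ∂ξ ∂(ν.prod ν) := by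
  have hg2 : MemLp (fun y : (T × T) × X => g y.1.2 y.2) 2 ((ν.prod ν).prod ξ) :=
    (hg.comp_snd ν).comp_measurePreserving (measurePreserving_prodAssoc ν ν ξ)
  have hf2 : MemLp (fun y : (T × T) × X => f y.1.1 y.2) 2 ((ν.prod ν).prod ξ) :=
    ((hf.comp_snd ν).comp_measurePreserving
      (measurePreserving_prodAssoc ν ν ξ)).comp_measurePreserving
        ((Measure.measurePreserving_swap (μ := ν) (ν := ν)).prod (MeasurePreserving.id ξ))
  have hint : Integrable (fun y : (T × T) × X => f y.1.1 y.2 * g y.1.2 y.2)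
      ((ν.prod ν).prod ξ) := hf2.integrable_mul hg2
  have hmul : ∀ x, (∫ τ, f τ x ∂ν) * (∫ τ, g τ x ∂ν) =
      ∫ z : T × T, f z.1 x * g z.2 x ∂(ν.prod ν) := fun x =>
    (integral_prod_mul (fun τ => f τ x) fun τ => g τ x).symm
  simp only [hmul]
  exact ⟨hint.integral_prod_right, (integral_integral_swap hint).symm⟩

lemma integral_prod_prod_kernel_le {ν : Measure T} [IsFiniteMeasure ν] {κ : T → T → ℝ}
    (hκ : Measurable (Function.uncurry κ)) (hκ0 : ∀ s t, 0 ≤ κ s t) (hκ1 : ∀ s t, κ s t ≤ 1)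
    {L : ℝ} (hL : ∀ s, ∫ t, κ s t ∂ν ≤ L) (hL0 : 0 ≤ L) :
    Integrable (fun y : (T × T) × (T × T) => κ y.1.1 y.1.2 * κ y.2.1 y.2.2 * κ y.1.1 y.2.1)
      ((ν.prod ν).prod (ν.prod ν)) ∧
    ∫ y : (T × T) × (T × T), κ y.1.1 y.1.2 * κ y.2.1 y.2.2 * κ y.1.1 y.2.1
      ∂((ν.prod ν).prod (ν.prod ν)) ≤ ν.real univ * L ^ 3 := by
  have hκm : ∀ {Y : Type _} [MeasurableSpace Y] {u w : Y → T}, Measurable u → Measurable w →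
      Measurable fun y => κ (u y) (w y) := fun hu hw => hκ.comp (hu.prodMk hw)
  have hbd : ∀ {Y : Type _} [MeasurableSpace Y] {μ : Measure Y} [IsFiniteMeasure μ] {u : Y → ℝ},
      Measurable u → (∀ y, 0 ≤ u y) → (∀ y, u y ≤ 1) → Integrable u μ := fun hu h0 h1 =>
    Integrable.of_bound hu.aestronglyMeasurable 1
      (Eventually.of_forall fun y => by rw [Real.norm_of_nonneg (h0 y)]; exact h1 y)
  have hκi : ∀ s, Integrable (fun t => κ s t) ν := fun s =>
    hbd (hκm measurable_const measurable_id) (hκ0 s) (hκ1 s)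
  have h3 : Integrable (fun y : (T × T) × (T × T) =>
      κ y.1.1 y.1.2 * κ y.2.1 y.2.2 * κ y.1.1 y.2.1) ((ν.prod ν).prod (ν.prod ν)) := by
    refine hbd ?_ (fun y => mul_nonneg (mul_nonneg (hκ0 _ _) (hκ0 _ _)) (hκ0 _ _)) fun y => ?_
    · exact ((hκm (by fun_prop) (by fun_prop)).mul (hκm (by fun_prop) (by fun_prop))).mul
        (hκm (by fun_prop) (by fun_prop))
    · exact mul_le_one₀ (mul_le_one₀ (hκ1 _ _) (hκ0 _ _) (hκ1 _ _)) (hκ0 _ _) (hκ1 _ _)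
  refine ⟨h3, ?_⟩
  have hinner : ∀ s, ∫ z : T × T, κ z.1 z.2 * κ s z.1 ∂(ν.prod ν) ≤ L ^ 2 := by
    intro s
    have hi : Integrable (fun z : T × T => κ z.1 z.2 * κ s z.1) (ν.prod ν) :=
      hbd ((hκm (by fun_prop) (by fun_prop)).mul (hκm (by fun_prop) (by fun_prop)))
        (fun y => mul_nonneg (hκ0 _ _) (hκ0 _ _))
        fun y => mul_le_one₀ (hκ1 _ _) (hκ0 _ _) (hκ1 _ _)
    rw [integral_prod _ hi]
    calc _ ≤ ∫ t, L * κ s t ∂ν := by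
          refine integral_mono hi.integral_prod_left ((hκi s).const_mul L) fun t => ?_
          simp only [integral_mul_const]
          exact mul_le_mul_of_nonneg_right (hL t) (hκ0 s t)
      _ ≤ L ^ 2 := by
          rw [integral_const_mul, sq]
          exact mul_le_mul_of_nonneg_left (hL s) hL0
  have hκp : Integrable (fun z : T × T => κ z.1 z.2) (ν.prod ν) :=
    hbd (hκm (by fun_prop) (by fun_prop)) (fun _ => hκ0 _ _) fun _ => hκ1 _ _
  rw [integral_prod _ h3]
  calc _ ≤ ∫ z : T × T, κ z.1 z.2 * L ^ 2 ∂(ν.prod ν) := by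
        refine integral_mono h3.integral_prod_left (hκp.mul_const _) fun z => ?_
        simp only [mul_assoc, integral_const_mul]
        exact mul_le_mul_of_nonneg_left (hinner z.1) (hκ0 _ _)
    _ = (∫ s, ∫ t, κ s t ∂ν ∂ν) * L ^ 2 := by rw [integral_mul_const, integral_prod _ hκp]
    _ ≤ (∫ _, L ∂ν) * L ^ 2 := by
        refine mul_le_mul_of_nonneg_right ?_ (sq_nonneg L)
        exact integral_mono hκp.integral_prod_left (integrable_const L) hL
    _ = ν.real univ * L ^ 3 := by rw [integral_const, smul_eq_mul]; ring

/-- Bound on the squared `L²` norm of the contraction of a mixture `∫ P τ x * Q τ y dν(τ)` of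
product functions whose correlations are dominated by a kernel `κ`. -/
lemma integral_contraction_sq_le {ν : Measure T} {α : Measure A} {β : Measure B}
    [IsFiniteMeasure ν] [IsFiniteMeasure α] [IsFiniteMeasure β]
    {P : T → A → ℝ} {Q : T → B → ℝ}
    (hPm : Measurable (Function.uncurry P)) (hQm : Measurable (Function.uncurry Q))
    (hP : ∀ τ, MemLp (P τ) 2 α) (hQ : ∀ τ, MemLp (Q τ) 2 β)
    {κ : T → T → ℝ} (hκ : Measurable (Function.uncurry κ)) (hκ0 : ∀ s t, 0 ≤ κ s t)
    (hκ1 : ∀ s t, κ s t ≤ 1) {L : ℝ} (hL : ∀ s, ∫ t, κ s t ∂ν ≤ L) (hL0 : 0 ≤ L)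
    {C : ℝ} (hC : 0 ≤ C)
    (hPc : ∀ s t, |∫ x, P s x * P t x ∂α| ≤ C * κ s t)
    (hQc : ∀ s t, |∫ y, Q s y * Q t y ∂β| ≤ C * κ s t)
    {G : A → B → ℝ} (hG : ∀ x y, Integrable (fun τ => P τ x * Q τ y) ν →
      G x y = ∫ τ, P τ x * Q τ y ∂ν) :
    ∫ y, ∫ y', (∫ x, G x y * G x y' ∂α) ^ 2 ∂β ∂β ≤ C ^ 4 * (ν.real univ * L ^ 3) := by
  have hCκ : ∀ s t, C * κ s t ≤ C := fun s t => mul_le_of_le_one_right hC (hκ1 s t)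
  have hPsq : ∀ τ, ∫ x, P τ x ^ 2 ∂α ≤ C := fun τ => by
    simp only [sq]; exact (le_abs_self _).trans ((hPc τ τ).trans (hCκ τ τ))
  have hQsq : ∀ τ, ∫ y, Q τ y ^ 2 ∂β ≤ C := fun τ => by
    simp only [sq]; exact (le_abs_self _).trans ((hQc τ τ).trans (hCκ τ τ))
  have hQL : MemLp (Function.uncurry Q) 2 (ν.prod β) :=
    memLp_two_uncurry_of_integral_sq_le hQm (fun τ => (hQ τ).integrable_sq)
      (integrable_const C) hQsq
  have hPQ : ∀ᵐ y ∂β, MemLp (Function.uncurry fun τ x => P τ x * Q τ y) 2 (ν.prod α) := by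
    filter_upwards [hQL.integrable_sq.prod_left_ae] with y hy
    have hQy : Measurable fun z : T × A => Q z.1 y :=
      hQm.comp (measurable_fst.prodMk measurable_const)
    refine memLp_two_uncurry_of_integral_sq_le (hPm.mul hQy) (fun τ => ?_) (hy.const_mul C)
      fun τ => ?_
    · simp only [mul_pow]; exact (hP τ).integrable_sq.mul_const _
    · simp only [mul_pow, integral_mul_const]
      exact mul_le_mul_of_nonneg_right (hPsq τ) (sq_nonneg _)
  set R : T × T → ℝ := fun z => ∫ x, P z.1 x * P z.2 x ∂α with hR
  have hRm : Measurable R := by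
    have : Measurable fun w : (T × T) × A => P w.1.1 w.2 * P w.1.2 w.2 :=
      (hPm.comp (by fun_prop : Measurable fun w : (T × T) × A => (w.1.1, w.2))).mul
        (hPm.comp (by fun_prop : Measurable fun w : (T × T) × A => (w.1.2, w.2)))
    exact this.stronglyMeasurable.integral_prod_right.measurable
  set K : T × T → B × B → ℝ := fun z w => R z * (Q z.1 w.1 * Q z.2 w.2) with hK
  have hKm : Measurable (Function.uncurry K) :=
    (hRm.comp measurable_fst).mul
      ((hQm.comp (by fun_prop : Measurable fun w : (T × T) × (B × B) => (w.1.1, w.2.1))).mul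
        (hQm.comp (by fun_prop : Measurable fun w : (T × T) × (B × B) => (w.1.2, w.2.2))))
  have hKL : MemLp (Function.uncurry K) 2 ((ν.prod ν).prod (β.prod β)) := by
    refine memLp_two_uncurry_of_integral_sq_le hKm (fun z => ?_)
      (integrable_const (C ^ 2 * (C * C))) fun z => ?_
    · simp only [hK, mul_pow]
      exact ((hQ z.1).integrable_sq.mul_prod (hQ z.2).integrable_sq).const_mul _
    · simp only [hK, mul_pow, integral_const_mul]
      rw [integral_prod_mul (fun y => Q z.1 y ^ 2) fun y => Q z.2 y ^ 2]
      have h0 : ∀ τ, 0 ≤ ∫ y, Q τ y ^ 2 ∂β := fun τ => integral_nonneg fun _ => sq_nonneg _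
      have hRC : R z ^ 2 ≤ C ^ 2 :=
        sq_le_sq.mpr (by rw [abs_of_nonneg hC]; exact (hPc _ _).trans (hCκ _ _))
      exact mul_le_mul hRC (mul_le_mul (hQsq _) (hQsq _) (h0 _) hC)
        (mul_nonneg (h0 _) (h0 _)) (sq_nonneg C)
  have hcon : ∀ᵐ y ∂β, ∀ᵐ y' ∂β, ∫ x, G x y * G x y' ∂α = ∫ z, K z (y, y') ∂(ν.prod ν) := by
    have hGae : ∀ y, MemLp (Function.uncurry fun τ x => P τ x * Q τ y) 2 (ν.prod α) →
        ∀ᵐ x ∂α, G x y = ∫ τ, P τ x * Q τ y ∂ν := fun y hy => by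
      filter_upwards [(hy.integrable one_le_two).prod_left_ae] with x hx using hG x y hx
    filter_upwards [hPQ] with y hy
    filter_upwards [hPQ] with y' hy'
    have : ∀ᵐ x ∂α, G x y * G x y' = (∫ τ, P τ x * Q τ y ∂ν) * ∫ τ, P τ x * Q τ y' ∂ν := by
      filter_upwards [hGae y hy, hGae y' hy'] with x h1 h2 using by rw [h1, h2]
    rw [integral_congr_ae this, (integrable_integral_mul_integral hy hy').2]
    refine integral_congr_ae (Eventually.of_forall fun z => ?_)
    simp only [hK, hR, ← integral_mul_const]
    exact integral_congr_ae (Eventually.of_forall fun x => by ring)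
  obtain ⟨hI, hE⟩ := integrable_integral_mul_integral hKL hKL
  have hEq : ∫ y, ∫ y', (∫ x, G x y * G x y' ∂α) ^ 2 ∂β ∂β =
      ∫ u : (T × T) × (T × T), ∫ w, K u.1 w * K u.2 w ∂(β.prod β)
        ∂((ν.prod ν).prod (ν.prod ν)) := by
    rw [← hE, integral_prod _ hI]
    refine integral_congr_ae ?_
    filter_upwards [hcon] with y hy
    refine integral_congr_ae ?_
    filter_upwards [hy] with y' hy' using by rw [hy', sq]
  obtain ⟨h3i, h3⟩ := integral_prod_prod_kernel_le hκ hκ0 hκ1 hL hL0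
  rw [hEq]
  refine (Real.le_norm_self _).trans ((norm_integral_le_of_norm_le (h3i.const_mul (C ^ 4))
    (Eventually.of_forall fun u => ?_)).trans ?_)
  · have : ∫ w, K u.1 w * K u.2 w ∂(β.prod β) =
        R u.1 * R u.2 * ((∫ y, Q u.1.1 y * Q u.2.1 y ∂β) * ∫ y, Q u.1.2 y * Q u.2.2 y ∂β) := by
      rw [← integral_prod_mul (fun y => Q u.1.1 y * Q u.2.1 y) fun y => Q u.1.2 y * Q u.2.2 y,
        ← integral_const_mul]
      exact integral_congr_ae (Eventually.of_forall fun w => by simp only [hK]; ring)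
    rw [this, Real.norm_eq_abs, abs_mul, abs_mul, abs_mul]
    calc _ ≤ (C * κ u.1.1 u.1.2) * (C * κ u.2.1 u.2.2) * ((C * κ u.1.1 u.2.1) * C) := by
          have hκC : ∀ s t, 0 ≤ C * κ s t := fun s t => mul_nonneg hC (hκ0 s t)
          gcongr
          · exact mul_nonneg (hκC _ _) (hκC _ _)
          · exact hκC _ _
          · exact hPc _ _
          · exact hPc _ _
          · exact hκC _ _
          · exact hQc _ _
          · exact (hQc _ _).trans (hCκ _ _)
      _ = _ := by ring
  · rw [integral_const_mul]
    exact mul_le_mul_of_nonneg_left h3 (by positivity)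

end Contraction

lemma Fin.prod_append_comp_cast {q p m : ℕ} (hq : q = p + m) (F : ℕ → ℝ → ℝ) (x : Fin p → ℝ)
    (y : Fin m → ℝ) :
    ∏ k : Fin q, F k ((Fin.append x y ∘ Fin.cast hq) k) =
      (∏ i : Fin p, F i (x i)) * ∏ j : Fin m, F (p + j) (y j) := by
  subst hq
  simp [Fin.prod_univ_add]

lemma abs_integral_prod_mul_prod_le {r : ℕ} (hr : 1 ≤ r) {μ : Measure ℝ} [SigmaFinite μ]
    {φ ψ : Fin r → ℝ → ℝ} {D k : ℝ} (hk0 : 0 ≤ k) (hk1 : k ≤ 1) (hD : 0 ≤ D)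
    (hle : ∀ i, |∫ y, φ i y * ψ i y ∂μ| ≤ D * k) :
    |∫ x : Fin r → ℝ, (∏ i, φ i (x i)) * ∏ i, ψ i (x i) ∂(Measure.pi fun _ => μ)| ≤ D ^ r * k := by
  simp only [← Finset.prod_mul_distrib]
  rw [integral_fintype_prod_eq_prod (fun i y => φ i y * ψ i y), Finset.abs_prod]
  calc _ ≤ ∏ _i : Fin r, D * k := Finset.prod_le_prod (fun _ _ => abs_nonneg _) fun i _ => hle i
    _ = D ^ r * k ^ r := by simp [mul_pow]
    _ ≤ D ^ r * k := by
        gcongr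
        exact pow_le_of_le_one hk0 hk1 (by omega)

lemma memLp_two_prod_apply {r : ℕ} {μ : Measure ℝ} [SigmaFinite μ] {φ : Fin r → ℝ → ℝ}
    (hm : ∀ i, Measurable (φ i)) (hφ : ∀ i, MemLp (φ i) 2 μ) :
    MemLp (fun x : Fin r → ℝ => ∏ i, φ i (x i)) 2 (Measure.pi fun _ => μ) := by
  have hm' : Measurable fun x : Fin r → ℝ => ∏ i, φ i (x i) :=
    Finset.measurable_prod _ fun i _ => (hm i).comp (measurable_pi_apply i)
  rw [memLp_two_iff_integrable_sq hm'.aestronglyMeasurable]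
  simp only [← Finset.prod_pow]
  exact Integrable.fintype_prod (f := fun i y => φ i y ^ 2) fun i => (hφ i).integrable_sq

lemma setIntegral_one_div_abs_sub_add_one_le {A B s : ℝ} (hs : s ∈ Icc A B) :
    ∫ t in Icc A B, 1 / (|s - t| + 1) ≤ 2 * log (B - A + 1) := by
  have hc : Continuous fun t : ℝ => 1 / (|s - t| + 1) :=
    continuous_const.div (by fun_prop) fun t => by positivity
  have hright : ∫ t in s..B, 1 / (|s - t| + 1) = log (B - s + 1) := by
    rw [intervalIntegral.integral_congr (g := fun t => 1 / (t - s + 1))]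
    · rw [intervalIntegral.integral_eq_sub_of_hasDerivAt (f := fun t => log (t - s + 1))]
      · simp
      · intro t ht
        rw [uIcc_of_le hs.2] at ht
        have : t - s + 1 ≠ 0 := by linarith [ht.1]
        exact (((hasDerivAt_id t).sub_const s).add_const 1).log this
      · refine ContinuousOn.intervalIntegrable fun t ht => ?_
        rw [uIcc_of_le hs.2] at ht
        have : t - s + 1 ≠ 0 := by linarith [ht.1]
        exact (by fun_prop (disch := assumption) : ContinuousAt _ t).continuousWithinAt
    · intro t ht
      rw [uIcc_of_le hs.2] at ht
      simp only
      rw [abs_sub_comm, abs_of_nonneg (by linarith [ht.1])]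
  have hleft : ∫ t in A..s, 1 / (|s - t| + 1) = log (s - A + 1) := by
    rw [intervalIntegral.integral_congr (g := fun t => 1 / (s - t + 1))]
    · rw [intervalIntegral.integral_eq_sub_of_hasDerivAt (f := fun t => - log (s - t + 1))]
      · simp
      · intro t ht
        rw [uIcc_of_le hs.1] at ht
        have : s - t + 1 ≠ 0 := by linarith [ht.2]
        have hd := ((((hasDerivAt_id t).const_sub s).add_const 1).log this).fun_neg
        rwa [neg_div, neg_neg] at hd
      · refine ContinuousOn.intervalIntegrable fun t ht => ?_
        rw [uIcc_of_le hs.1] at ht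
        have : s - t + 1 ≠ 0 := by linarith [ht.2]
        exact (by fun_prop (disch := assumption) : ContinuousAt _ t).continuousWithinAt
    · intro t ht
      rw [uIcc_of_le hs.1] at ht
      simp only
      rw [abs_of_nonneg (by linarith [ht.2])]
  rw [integral_Icc_eq_integral_Ioc, ← intervalIntegral.integral_of_le (hs.1.trans hs.2),
    ← intervalIntegral.integral_add_adjacent_intervals (hc.intervalIntegrable A s)
      (hc.intervalIntegrable s B), hleft, hright, two_mul]
  have h1 := hs.1
  have h2 := hs.2
  exact add_le_add (log_le_log (by linarith) (by linarith)) (log_le_log (by linarith) (by linarith))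

/-- The contraction bound for a single mixture over an interval, with the constant explicit in the
length of the interval. -/
lemma integral_contraction_sq_le_log {A' B' : ℝ} (q : ℕ) (c : ℕ → ℝ) {h h' : ℝ → ℝ → ℝ}
    {v : ℝ → ℝ} (hmeas : Measurable (Function.uncurry h))
    (hmeas' : Measurable (Function.uncurry h')) (hmeasv : Measurable v)
    {C₀ : ℝ} (hC₀ : 0 < C₀) (hAB : A' ≤ B')
    (hnorm : ∀ s ∈ Icc A' B', (∫ y in Icc (0 : ℝ) 1, h s y ^ 2) = 1 ∧
      (∫ y in Icc (0 : ℝ) 1, h' s y ^ 2) = 1)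
    (hcor1 : ∀ s ∈ Icc A' B', ∀ t ∈ Icc A' B',
      |∫ y in Icc (0 : ℝ) 1, h s y * h t y| ≤ C₀ / (|s - t| + 1))
    (hcor2 : ∀ s ∈ Icc A' B', ∀ t ∈ Icc A' B',
      |∫ y in Icc (0 : ℝ) 1, h s y * h' t y| ≤ C₀ / (|s - t| + 1))
    (hcor3 : ∀ s ∈ Icc A' B', ∀ t ∈ Icc A' B',
      |∫ y in Icc (0 : ℝ) 1, h' s y * h' t y| ≤ C₀ / (|s - t| + 1))
    (hv : ∀ s ∈ Icc A' B', |v s| ≤ C₀) {p m : ℕ} (hp : 1 ≤ p) (hm : 1 ≤ m) (hq : q = p + m)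
    {G : (Fin q → ℝ) → ℝ} (hG : ∀ w, G w = ∫ s in Icc A' B',
        (∑ l ∈ Finset.range (q / 2 + 1), c l *
          (∏ k : Fin q, if (k : ℕ) < q - 2 * l then h s (w k) else h' s (w k)) * v s)) :
    ∫ y : Fin m → ℝ, ∫ y' : Fin m → ℝ, (∫ x : Fin p → ℝ,
        G (Fin.append x y ∘ Fin.cast hq) * G (Fin.append x y' ∘ Fin.cast hq)
          ∂(Measure.pi fun _ => volume.restrict (Icc (0 : ℝ) 1))) ^ 2
        ∂(Measure.pi fun _ => volume.restrict (Icc (0 : ℝ) 1))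
        ∂(Measure.pi fun _ => volume.restrict (Icc (0 : ℝ) 1)) ≤
      (((∑ l ∈ Finset.range (q / 2 + 1), |c l|) * C₀) ^ 2 * C₀ ^ p + C₀ ^ m) ^ 4 *
        ((B' - A') * ((q / 2 + 1 : ℕ) : ℝ) *
          (((q / 2 + 1 : ℕ) : ℝ) * (2 * log (B' - A' + 1))) ^ 3) := by
  set I := Icc A' B' with hI
  set μ : Measure ℝ := volume.restrict (Icc (0 : ℝ) 1) with hμ
  set N := q / 2 + 1 with hN
  set W := (∑ l ∈ Finset.range N, |c l|) * C₀ with hW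
  have hIm : MeasurableSet I := measurableSet_Icc
  have hW0 : 0 ≤ W := mul_nonneg (Finset.sum_nonneg fun _ _ => abs_nonneg _) hC₀.le
  have hlog : 0 ≤ log (B' - A' + 1) := log_nonneg (by linarith)
  set e : ℕ → ℕ → ℝ → ℝ → ℝ := fun l j s y => if j < q - 2 * l then h s y else h' s y with he
  have hem : ∀ l j, Measurable (Function.uncurry (e l j)) := fun l j => by
    by_cases hj : j < q - 2 * l
    · simpa only [he, hj, if_true] using hmeas
    · simpa only [he, hj, if_false] using hmeas'
  have hem1 : ∀ l j s, Measurable (e l j s) := fun l j s =>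
    (hem l j).comp (measurable_const.prodMk measurable_id)
  have heL : ∀ l j, ∀ s ∈ I, MemLp (e l j s) 2 μ := fun l j s hs => by
    rw [memLp_two_iff_integrable_sq (hem1 l j s).aestronglyMeasurable]
    refine Integrable.of_integral_ne_zero ?_
    by_cases hj : j < q - 2 * l
    · simp only [he, hj, if_true, (hnorm s hs).1]; exact one_ne_zero
    · simp only [he, hj, if_false, (hnorm s hs).2]; exact one_ne_zero
  have hec : ∀ l l' j, ∀ s ∈ I, ∀ t ∈ I,
      |∫ y, e l j s y * e l' j t y ∂μ| ≤ C₀ * (1 / (|s - t| + 1)) := fun l l' j s hs t ht => by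
    rw [mul_one_div]
    by_cases hj : j < q - 2 * l <;> by_cases hj' : j < q - 2 * l' <;>
      simp only [he, hj, hj', if_true, if_false]
    · exact hcor1 s hs t ht
    · exact hcor2 s hs t ht
    · simp only [mul_comm (h' s _), abs_sub_comm s t]
      exact hcor2 t ht s hs
    · exact hcor3 s hs t ht
  set ν : Measure (ℝ × Fin N) := (volume.restrict I).prod Measure.count with hν
  have hwC : ∀ τ : ℝ × Fin N, |I.indicator (fun s => c τ.2 * v s) τ.1| ≤ W := fun τ => by
    by_cases hs : τ.1 ∈ I
    · rw [indicator_of_mem hs, abs_mul]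
      refine mul_le_mul ?_ (hv _ hs) (abs_nonneg _) (Finset.sum_nonneg fun _ _ => abs_nonneg _)
      exact Finset.single_le_sum (f := fun l => |c l|) (fun _ _ => abs_nonneg _)
        (Finset.mem_range.mpr τ.2.2)
    · rw [indicator_of_notMem hs, abs_zero]; exact hW0
  set P : ℝ × Fin N → (Fin p → ℝ) → ℝ := fun τ x =>
    I.indicator (fun s => c τ.2 * v s) τ.1 * ∏ i : Fin p, e τ.2 i τ.1 (x i) with hP
  set Q : ℝ × Fin N → (Fin m → ℝ) → ℝ := fun τ y =>
    I.indicator (fun _ => 1) τ.1 * ∏ j : Fin m, e τ.2 (p + j) τ.1 (y j) with hQ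
  set κ : ℝ × Fin N → ℝ × Fin N → ℝ := fun σ τ =>
    I.indicator (fun _ => 1) σ.1 * (1 / (|σ.1 - τ.1| + 1)) with hκ
  have hfst : MeasurableSet (Prod.fst ⁻¹' I : Set (ℝ × Fin N)) := measurable_fst hIm
  have hind : Measurable fun τ : ℝ × Fin N => I.indicator (fun _ => (1 : ℝ)) τ.1 :=
    (measurable_const.indicator hIm).comp measurable_fst
  have hprodm : ∀ {r : ℕ} (k : ℕ), Measurable fun z : (ℝ × Fin N) × (Fin r → ℝ) =>
      ∏ i : Fin r, e z.1.2 (k + i) z.1.1 (z.2 i) := fun {r} k => by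
    refine Finset.measurable_prod _ fun i _ => ?_
    have hm0 : Measurable fun z : Fin N × (ℝ × (Fin r → ℝ)) =>
        e z.1 (k + i) z.2.1 (z.2.2 i) := by
      refine measurable_from_prod_countable_right fun l => ?_
      exact (hem l (k + i)).comp
        (by fun_prop : Measurable fun z : ℝ × (Fin r → ℝ) => (z.1, z.2 i))
    exact hm0.comp (by fun_prop :
      Measurable fun z : (ℝ × Fin N) × (Fin r → ℝ) => (z.1.2, (z.1.1, z.2)))
  have hwm : Measurable fun τ : ℝ × Fin N => I.indicator (fun s => c τ.2 * v s) τ.1 := by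
    have hcm : Measurable fun l : Fin N => c l := measurable_of_finite _
    exact ((hcm.comp measurable_snd).mul (hmeasv.comp measurable_fst)).indicator hfst
  have hPm : Measurable (Function.uncurry P) := by
    have := (hwm.comp measurable_fst).mul (hprodm (r := p) 0)
    simp only [Nat.zero_add] at this
    exact this
  have hQm : Measurable (Function.uncurry Q) := (hind.comp measurable_fst).mul (hprodm (r := m) p)
  have hPL : ∀ τ, MemLp (P τ) 2 (Measure.pi fun _ => μ) := fun τ => by
    by_cases hs : τ.1 ∈ I
    · exact (memLp_two_prod_apply (φ := fun i => e τ.2 i τ.1) (fun i => hem1 _ _ _)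
        fun i => heL _ _ _ hs).const_mul _
    · simp only [hP, indicator_of_notMem hs, zero_mul]; exact MemLp.zero
  have hQL : ∀ τ, MemLp (Q τ) 2 (Measure.pi fun _ => μ) := fun τ => by
    by_cases hs : τ.1 ∈ I
    · exact (memLp_two_prod_apply (φ := fun j => e τ.2 (p + j) τ.1) (fun i => hem1 _ _ _)
        fun i => heL _ _ _ hs).const_mul _
    · simp only [hQ, indicator_of_notMem hs, zero_mul]; exact MemLp.zero
  have hk0 : ∀ u : ℝ, 0 ≤ 1 / (|u| + 1) := fun u => by positivity
  have hk1 : ∀ u : ℝ, 1 / (|u| + 1) ≤ 1 := fun u =>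
    (div_le_one (by positivity)).mpr (by linarith [abs_nonneg u])
  have hκm : Measurable (Function.uncurry κ) := by
    refine (hind.comp measurable_fst).mul ?_
    fun_prop
  have hκ0 : ∀ σ τ, 0 ≤ κ σ τ := fun σ τ =>
    mul_nonneg (indicator_nonneg (fun _ _ => zero_le_one) _) (hk0 _)
  have hκ1 : ∀ σ τ, κ σ τ ≤ 1 := fun σ τ =>
    mul_le_one₀ (indicator_le_self' (fun _ _ => zero_le_one) _) (hk0 _) (hk1 _)
  have hνu : ν.real univ = (B' - A') * N := by
    simp [hν, hI, measureReal_def, ← univ_prod_univ, Measure.prod_prod, hAB]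
  have hκL : ∀ σ, ∫ τ, κ σ τ ∂ν ≤ N * (2 * log (B' - A' + 1)) := fun σ => by
    by_cases hs : σ.1 ∈ I
    · simp only [hκ, indicator_of_mem hs, one_mul, hν]
      have := integral_prod_mul (μ := volume.restrict I) (ν := (Measure.count : Measure (Fin N)))
        (fun t => 1 / (|σ.1 - t| + 1)) (fun _ => (1 : ℝ))
      simp only [mul_one] at this
      rw [this, mul_comm (N : ℝ)]
      have hcount : ∫ _ : Fin N, (1 : ℝ) ∂Measure.count = N := by simp [measureReal_def]
      rw [hcount]
      exact mul_le_mul_of_nonneg_right (setIntegral_one_div_abs_sub_add_one_le hs)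
        (Nat.cast_nonneg _)
    · simp only [hκ, indicator_of_notMem hs, zero_mul, integral_zero]
      positivity
  set C := W ^ 2 * C₀ ^ p + C₀ ^ m with hC
  have hCP : W ^ 2 * C₀ ^ p ≤ C := le_add_of_nonneg_right (by positivity)
  have hCQ : C₀ ^ m ≤ C := le_add_of_nonneg_left (by positivity)
  have hC0 : 0 ≤ C := by positivity
  have hPc : ∀ σ τ, |∫ x, P σ x * P τ x ∂(Measure.pi fun _ => μ)| ≤ C * κ σ τ := fun σ τ => by
    by_cases hs : σ.1 ∈ I
    · by_cases ht : τ.1 ∈ I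
      · have hb := abs_integral_prod_mul_prod_le hp (μ := μ) (φ := fun i => e σ.2 i σ.1)
          (ψ := fun i => e τ.2 i τ.1) (hk0 (σ.1 - τ.1)) (hk1 _) hC₀.le
          fun i => hec _ _ _ _ hs _ ht
        simp only [hP, mul_mul_mul_comm, integral_const_mul, abs_mul]
        calc _ ≤ W * W * (C₀ ^ p * (1 / (|σ.1 - τ.1| + 1))) :=
              mul_le_mul (mul_le_mul (hwC σ) (hwC τ) (abs_nonneg _) hW0) hb (abs_nonneg _)
                (mul_nonneg hW0 hW0)
          _ = (W ^ 2 * C₀ ^ p) * κ σ τ := by simp only [hκ, indicator_of_mem hs]; ring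
          _ ≤ C * κ σ τ := mul_le_mul_of_nonneg_right hCP (hκ0 _ _)
      · simp only [hP, indicator_of_notMem ht, zero_mul, mul_zero, integral_zero, abs_zero]
        exact mul_nonneg hC0 (hκ0 _ _)
    · simp only [hP, indicator_of_notMem hs, zero_mul, integral_zero, abs_zero]
      exact mul_nonneg hC0 (hκ0 _ _)
  have hQc : ∀ σ τ, |∫ x, Q σ x * Q τ x ∂(Measure.pi fun _ => μ)| ≤ C * κ σ τ := fun σ τ => by
    by_cases hs : σ.1 ∈ I
    · by_cases ht : τ.1 ∈ I
      · have hb := abs_integral_prod_mul_prod_le hm (μ := μ) (φ := fun j => e σ.2 (p + j) σ.1)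
          (ψ := fun j => e τ.2 (p + j) τ.1) (hk0 (σ.1 - τ.1)) (hk1 _) hC₀.le
          fun i => hec _ _ _ _ hs _ ht
        simp only [hQ, hκ, indicator_of_mem hs, indicator_of_mem ht, one_mul]
        exact hb.trans (mul_le_mul_of_nonneg_right hCQ (hk0 _))
      · simp only [hQ, indicator_of_notMem ht, zero_mul, mul_zero, integral_zero, abs_zero]
        exact mul_nonneg hC0 (hκ0 _ _)
    · simp only [hQ, indicator_of_notMem hs, zero_mul, integral_zero, abs_zero]
      exact mul_nonneg hC0 (hκ0 _ _)
  have hGPQ : ∀ (x : Fin p → ℝ) (y : Fin m → ℝ), Integrable (fun τ => P τ x * Q τ y) ν →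
      G (Fin.append x y ∘ Fin.cast hq) = ∫ τ, P τ x * Q τ y ∂ν := fun x y hxy => by
    rw [hG, hν, integral_prod _ hxy]
    refine setIntegral_congr_fun hIm fun s hs => ?_
    rw [integral_fintype .of_finite, Finset.sum_range]
    refine Finset.sum_congr rfl fun l _ => ?_
    have hsplit := Fin.prod_append_comp_cast hq (fun j y => e l j s y) x y
    simp only [he] at hsplit
    rw [hsplit]
    simp only [hP, hQ, he, indicator_of_mem hs, measureReal_def, Measure.count_singleton,
      ENNReal.toReal_one, one_smul, one_mul]
    ring
  rw [← hνu]
  exact integral_contraction_sq_le (G := fun x y => G (Fin.append x y ∘ Fin.cast hq))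
    hPm hQm hPL hQL hκm hκ0 hκ1 hκL (by positivity) hC0 hPc hQc hGPQ

lemma tendsto_log_pow_three_div_atTop {d : ℝ} (hd : 0 < d) :
    Tendsto (fun n : ℕ => log (n * d + 1) ^ 3 / n) atTop (nhds 0) := by
  have hx : Tendsto (fun n : ℕ => (n : ℝ) * (d + 1)) atTop atTop :=
    tendsto_natCast_atTop_atTop.atTop_mul_const (by linarith)
  have h1 : Tendsto (fun n : ℕ => (d + 1) *
      (log ((n : ℝ) * (d + 1)) ^ 3 / ((n : ℝ) * (d + 1)))) atTop (nhds 0) := by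
    simpa using ((isLittleO_pow_log_id_atTop (n := 3)).tendsto_div_nhds_zero.comp hx).const_mul
      (d + 1)
  refine squeeze_zero' (Eventually.of_forall fun n => ?_) ?_ h1
  · have hnd : 0 ≤ (n : ℝ) * d := by positivity
    have : 0 ≤ log (n * d + 1) := log_nonneg (by linarith)
    positivity
  · filter_upwards [eventually_ge_atTop 1] with n hn
    have hn' : (1 : ℝ) ≤ n := by exact_mod_cast hn
    have h0 : 0 ≤ (n : ℝ) * d := by positivity
    have hle : log (n * d + 1) ≤ log (n * (d + 1)) := log_le_log (by linarith) (by linarith)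
    have hl0 : 0 ≤ log (n * d + 1) := log_nonneg (by linarith)
    calc log (n * d + 1) ^ 3 / n ≤ log (n * (d + 1)) ^ 3 / n := by gcongr
      _ = _ := by field_simp

theorem contraction_norm_tendsto_zero (a b : ℝ) (hab : a < b) (q : ℕ) (hq : 2 ≤ q)
    (c : ℕ → ℝ) (h h' : ℕ → ℝ → ℝ → ℝ) (v : ℕ → ℝ → ℝ)
    (hmeas : ∀ n, Measurable (Function.uncurry (h n)))
    (hmeas' : ∀ n, Measurable (Function.uncurry (h' n)))
    (hmeasv : ∀ n, Measurable (v n))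
    (c₀ C₀ : ℝ) (hc₀ : 0 < c₀) (hC₀ : 0 < C₀)
    (hnorm : ∀ n : ℕ, 1 ≤ n → ∀ s ∈ Set.Icc ((n : ℝ) * a) ((n : ℝ) * b),
      (∫ lam in Set.Icc (0:ℝ) 1, (h n s lam) ^ 2) = 1 ∧
      (∫ lam in Set.Icc (0:ℝ) 1, (h' n s lam) ^ 2) = 1)
    (hcor1 : ∀ n : ℕ, 1 ≤ n → ∀ s ∈ Set.Icc ((n : ℝ) * a) ((n : ℝ) * b),
      ∀ t ∈ Set.Icc ((n : ℝ) * a) ((n : ℝ) * b),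
        |∫ lam in Set.Icc (0:ℝ) 1, h n s lam * h n t lam| ≤ C₀ / (|s - t| + 1))
    (hcor2 : ∀ n : ℕ, 1 ≤ n → ∀ s ∈ Set.Icc ((n : ℝ) * a) ((n : ℝ) * b),
      ∀ t ∈ Set.Icc ((n : ℝ) * a) ((n : ℝ) * b),
        |∫ lam in Set.Icc (0:ℝ) 1, h n s lam * h' n t lam| ≤ C₀ / (|s - t| + 1))
    (hcor3 : ∀ n : ℕ, 1 ≤ n → ∀ s ∈ Set.Icc ((n : ℝ) * a) ((n : ℝ) * b),
      ∀ t ∈ Set.Icc ((n : ℝ) * a) ((n : ℝ) * b),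
        |∫ lam in Set.Icc (0:ℝ) 1, h' n s lam * h' n t lam| ≤ C₀ / (|s - t| + 1))
    (hv : ∀ n : ℕ, 1 ≤ n → ∀ s ∈ Set.Icc ((n : ℝ) * a) ((n : ℝ) * b),
      c₀ ≤ v n s ∧ v n s ≤ C₀)
    (g : ℕ → (Fin q → ℝ) → ℝ)
    (hg : ∀ n : ℕ, ∀ lam : Fin q → ℝ,
      g n lam = (1 / Real.sqrt n) * ∫ s in Set.Icc ((n : ℝ) * a) ((n : ℝ) * b),
        (∑ l ∈ Finset.range (q / 2 + 1), c l *
          (∏ k : Fin q, if (k : ℕ) < q - 2 * l then h n s (lam k) else h' n s (lam k))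
          * v n s))
    (p : ℕ) (hp1 : 1 ≤ p) (hpq : p ≤ q - 1) :
    Tendsto (fun n : ℕ =>
        ∫ lam : Fin (q - p) → ℝ,
          ∫ lam' : Fin (q - p) → ℝ,
            (∫ x : Fin p → ℝ,
                g n (Fin.append x lam ∘ Fin.cast (by omega))
                  * g n (Fin.append x lam' ∘ Fin.cast (by omega))
              ∂(Measure.pi fun _ : Fin p => volume.restrict (Set.Icc (0:ℝ) 1))) ^ 2
          ∂(Measure.pi fun _ : Fin (q - p) => volume.restrict (Set.Icc (0:ℝ) 1))
        ∂(Measure.pi fun _ : Fin (q - p) => volume.restrict (Set.Icc (0:ℝ) 1)))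
      atTop (nhds 0) := by
  have hq' : q = p + (q - p) := by omega
  set D := (((∑ l ∈ Finset.range (q / 2 + 1), |c l|) * C₀) ^ 2 * C₀ ^ p + C₀ ^ (q - p)) ^ 4 *
    ((b - a) * ((q / 2 + 1 : ℕ) : ℝ) * (((q / 2 + 1 : ℕ) : ℝ) * 2) ^ 3) with hD
  have hlim : Tendsto (fun n : ℕ => D * (log (n * (b - a) + 1) ^ 3 / n)) atTop (nhds 0) := by
    simpa using (tendsto_log_pow_three_div_atTop (sub_pos.mpr hab)).const_mul D
  refine squeeze_zero' (Eventually.of_forall fun n => ?_) ?_ hlim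
  · exact integral_nonneg fun _ => integral_nonneg fun _ => sq_nonneg _
  filter_upwards [eventually_ge_atTop 1] with n hn
  have hn0 : (0 : ℝ) < n := by exact_mod_cast hn
  have hsqrt : √(n : ℝ) ≠ 0 := (Real.sqrt_pos.mpr hn0).ne'
  have key := integral_contraction_sq_le_log q c (hmeas n) (hmeas' n) (hmeasv n) hC₀
    (mul_le_mul_of_nonneg_left hab.le hn0.le) (hnorm n hn) (hcor1 n hn) (hcor2 n hn) (hcor3 n hn)
    (fun s hs => by
      rw [abs_of_pos (hc₀.trans_le (hv n hn s hs).1)]; exact (hv n hn s hs).2)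
    hp1 (by omega) hq' (G := fun w => √(n : ℝ) * g n w)
    (fun w => by rw [hg, ← mul_assoc, mul_one_div_cancel hsqrt, one_mul])
  have hsq : √(n : ℝ) * √(n : ℝ) = n := Real.mul_self_sqrt hn0.le
  simp only [mul_mul_mul_comm _ (g n _), hsq, integral_const_mul, mul_pow] at key
  rw [← mul_sub] at key
  refine le_of_mul_le_mul_left (key.trans_eq ?_) (pow_pos hn0 2)
  rw [hD]
  field_simp
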